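/- Let R₁ and R₂ be rings and Γ = R₁ × R₂ their product ring. For a left Γ-module N = N₁ ⊕ N₂ (with N₁ a left R₁-module and N₂ a left R₂-module), the Gorenstein projective dimension satisfies Gpd_Γ(N) ≤ max{Gpd_{R₁}(N₁), Gpd_{R₂}(N₂)}; in particular, if Gpd_{R₁}(N₁) < ∞ and Gpd_{R₂}(N₂) < ∞ then Gpd_Γ(N) < ∞. -/

import Mathlib

/-!
Common definitions: Gorenstein projective/flat modules, Ext-vanishing via projective
resolutions, Gorenstein projective dimension, flat and cotorsion modules over an
arbitrary (possibly noncommutative) ring, tensor product of a right module with a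
left module, coherence and perfectness conditions.
-/

universe u v

noncomputable section

open Function

namespace GorensteinPrecover

section Tensor

variable (R : Type u) [Ring R]

/-- The subgroup of `I ⊗ₗ[ℤ] F` by which one quotients to obtain the tensor product
`I ⊗[R] F` of a right `R`-module `I` with a left `R`-module `F`. -/
def tensorRel (I : Type v) [AddCommGroup I] [Module Rᵐᵒᵖ I]
    (F : Type v) [AddCommGroup F] [Module R F] :
    AddSubgroup (TensorProduct ℤ I F) :=
  AddSubgroup.closure
    {z | ∃ (r : R) (x : I) (y : F),
      z = (MulOpposite.op r • x) ⊗ₜ[ℤ] y - x ⊗ₜ[ℤ] (r • y)}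

/-- The tensor product `I ⊗[R] F` (an abelian group) of a right `R`-module `I` with a
left `R`-module `F` over a possibly noncommutative ring `R`. -/
def RTensor (I : Type v) [AddCommGroup I] [Module Rᵐᵒᵖ I]
    (F : Type v) [AddCommGroup F] [Module R F] : Type v :=
  TensorProduct ℤ I F ⧸ tensorRel R I F

instance (I : Type v) [AddCommGroup I] [Module Rᵐᵒᵖ I]
    (F : Type v) [AddCommGroup F] [Module R F] : AddCommGroup (RTensor R I F) :=
  QuotientAddGroup.Quotient.addCommGroup _

/-- Functoriality of `I ⊗[R] -` in the left module variable. -/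
def rtMap (I : Type v) [AddCommGroup I] [Module Rᵐᵒᵖ I]
    {F F' : Type v} [AddCommGroup F] [Module R F] [AddCommGroup F'] [Module R F']
    (g : F →ₗ[R] F') : RTensor R I F →+ RTensor R I F' :=
  QuotientAddGroup.map _ _
    (TensorProduct.map (LinearMap.id) (g.toAddMonoidHom.toIntLinearMap)).toAddMonoidHom
    (by
      refine (AddSubgroup.closure_le _).2 ?_
      rintro _ ⟨r, x, y, rfl⟩
      refine AddSubgroup.mem_comap.2 (AddSubgroup.subset_closure ⟨r, x, g y, ?_⟩)
      simp [TensorProduct.map_tmul, map_smul])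

/-- Functoriality of `- ⊗[R] F` in the right module variable. -/
def rtMapRight {I I' : Type v} [AddCommGroup I] [Module Rᵐᵒᵖ I]
    [AddCommGroup I'] [Module Rᵐᵒᵖ I']
    (F : Type v) [AddCommGroup F] [Module R F]
    (f : I →ₗ[Rᵐᵒᵖ] I') : RTensor R I F →+ RTensor R I' F :=
  QuotientAddGroup.map _ _
    (TensorProduct.map (f.toAddMonoidHom.toIntLinearMap) (LinearMap.id)).toAddMonoidHom
    (by
      refine (AddSubgroup.closure_le _).2 ?_
      rintro _ ⟨r, x, y, rfl⟩
      refine AddSubgroup.mem_comap.2 (AddSubgroup.subset_closure ⟨r, f x, y, ?_⟩)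
      simp [TensorProduct.map_tmul, map_smul])

end Tensor

section Defs

variable (R : Type u) [Ring R]

/-- A left `R`-module `M` is *Gorenstein projective* if there is an exact complex of
projective modules `⋯ → P₁ → P₀ → P₋₁ → ⋯` which stays exact after applying
`Hom(-, Q)` for every projective module `Q`, with `M ≅ ker (P₀ → P₋₁)`. -/
def IsGorensteinProjective (M : ModuleCat.{v} R) : Prop :=
  ∃ (P : ℤ → ModuleCat.{v} R) (d : ∀ i : ℤ, P (i + 1) →ₗ[R] P i),
    (∀ i, Module.Projective R (P i)) ∧
    (∀ i, Function.Exact (d (i + 1)) (d i)) ∧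
    (∀ Q : ModuleCat.{v} R, Module.Projective R Q →
      ∀ i : ℤ, Function.Exact
        (fun f : P i →ₗ[R] Q => f.comp (d i))
        (fun f : P (i + 1) →ₗ[R] Q => f.comp (d (i + 1)))) ∧
    Nonempty (M ≃ₗ[R] LinearMap.ker (d (-1)))

/-- A left `R`-module `M` is *flat* if tensoring with it preserves injectivity of maps
of right `R`-modules. -/
def IsFlatMod (M : ModuleCat.{v} R) : Prop :=
  ∀ (I I' : ModuleCat.{v} Rᵐᵒᵖ) (f : I →ₗ[Rᵐᵒᵖ] I'), Function.Injective f →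
    Function.Injective (rtMapRight R (M : Type v) f)

/-- A left `R`-module `M` is *Gorenstein flat* if there is an exact complex of flat
modules `⋯ → F₁ → F₀ → F₋₁ → ⋯` which stays exact after applying `I ⊗[R] -` for every
injective right `R`-module `I`, with `M ≅ ker (F₀ → F₋₁)`. -/
def IsGorensteinFlat (M : ModuleCat.{v} R) : Prop :=
  ∃ (F : ℤ → ModuleCat.{v} R) (d : ∀ i : ℤ, F (i + 1) →ₗ[R] F i),
    (∀ i, IsFlatMod R (F i)) ∧
    (∀ i, Function.Exact (d (i + 1)) (d i)) ∧
    (∀ I : ModuleCat.{v} Rᵐᵒᵖ, Module.Injective Rᵐᵒᵖ I →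
      ∀ i : ℤ, Function.Exact
        (rtMap R (I : Type v) (d (i + 1))) (rtMap R (I : Type v) (d i))) ∧
    Nonempty (M ≃ₗ[R] LinearMap.ker (d (-1)))

/-- A projective resolution `⋯ → P₁ → P₀ → M → 0` of a left `R`-module `M`. -/
structure ProjRes (M : ModuleCat.{v} R) where
  P : ℕ → ModuleCat.{v} R
  d : ∀ i : ℕ, P (i + 1) →ₗ[R] P i
  π : P 0 →ₗ[R] M
  projective : ∀ i, Module.Projective R (P i)
  surj : Function.Surjective π
  exact0 : Function.Exact (d 0) π
  exact : ∀ i, Function.Exact (d (i + 1)) (d i)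

/-- `ExtVanish R X Y m` says that `Ext^{m+1}_R(X, Y) = 0`, expressed by the exactness
of `Hom(P_m, Y) → Hom(P_{m+1}, Y) → Hom(P_{m+2}, Y)` for every projective resolution
`P` of `X`. -/
def ExtVanish (X Y : ModuleCat.{v} R) (m : ℕ) : Prop :=
  ∀ res : ProjRes R X,
    Function.Exact
      (fun f : res.P m →ₗ[R] Y => f.comp (res.d m))
      (fun f : res.P (m + 1) →ₗ[R] Y => f.comp (res.d (m + 1)))

/-- `Ext¹_R(X, Y) = 0`. -/
def Ext1Zero (X Y : ModuleCat.{v} R) : Prop := ExtVanish R X Y 0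

/-- `Y` lies in the right orthogonal class `GP^⊥` of the Gorenstein projective
modules: `Ext¹(G, Y) = 0` for every Gorenstein projective `G`. -/
def InGPOrth (Y : ModuleCat.{v} R) : Prop :=
  ∀ G : ModuleCat.{v} R, IsGorensteinProjective R G → Ext1Zero R G Y

/-- The Gorenstein projective dimension of `M` is at most `n`: there is an exact
sequence `0 → G_n → ⋯ → G_0 → M → 0` with all `G_i` Gorenstein projective (encoded by
an `ℕ`-indexed resolution vanishing in degrees `> n`). -/
def GorProjDimLE (M : ModuleCat.{v} R) (n : ℕ) : Prop :=
  ∃ (G : ℕ → ModuleCat.{v} R) (d : ∀ i : ℕ, G (i + 1) →ₗ[R] G i) (π : G 0 →ₗ[R] M),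
    (∀ i, IsGorensteinProjective R (G i)) ∧
    Function.Surjective π ∧
    Function.Exact (d 0) π ∧
    (∀ i, Function.Exact (d (i + 1)) (d i)) ∧
    (∀ i, n < i → Subsingleton (G i : Type v))

/-- The projective dimension of `M` is at most `n`: there is an exact sequence
`0 → P_n → ⋯ → P_0 → M → 0` with all `P_i` projective. -/
def ProjDimLE (M : ModuleCat.{v} R) (n : ℕ) : Prop :=
  ∃ (P : ℕ → ModuleCat.{v} R) (d : ∀ i : ℕ, P (i + 1) →ₗ[R] P i) (π : P 0 →ₗ[R] M),
    (∀ i, Module.Projective R (P i)) ∧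
    Function.Surjective π ∧
    Function.Exact (d 0) π ∧
    (∀ i, Function.Exact (d (i + 1)) (d i)) ∧
    (∀ i, n < i → Subsingleton (P i : Type v))

/-- A left `R`-module `C` is *cotorsion* if `Ext¹(K, C) = 0` for every flat `K`. -/
def IsCotorsion (C : ModuleCat.{v} R) : Prop :=
  ∀ K : ModuleCat.{v} R, IsFlatMod R K → Ext1Zero R K C

/-- The ring `R` is *left GF-closed* if the class of Gorenstein flat left `R`-modules
is closed under extensions. -/
def GFClosed : Prop :=
  ∀ (A B C : ModuleCat.{v} R) (f : A →ₗ[R] B) (g : B →ₗ[R] C),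
    Function.Injective f → Function.Surjective g → Function.Exact f g →
    IsGorensteinFlat R A → IsGorensteinFlat R C → IsGorensteinFlat R B

/-- The ring `R` is *right coherent* if every direct product of flat left `R`-modules
is flat. -/
def RightCoherent : Prop :=
  ∀ (ι : Type v) (M : ι → ModuleCat.{v} R), (∀ i, IsFlatMod R (M i)) →
    IsFlatMod R (ModuleCat.of R (∀ i, (M i : Type v)))

/-- The ring `R` is *left `n`-perfect* if every flat left `R`-module has projective
dimension at most `n`. -/
def LeftNPerfect (n : ℕ) : Prop :=
  ∀ F : ModuleCat.{v} R, IsFlatMod R F → ProjDimLE R F n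

/-- The ring `R` is *left perfect* if every flat left `R`-module is projective. -/
def LeftPerfect : Prop :=
  ∀ F : ModuleCat.{v} R, IsFlatMod R F → Module.Projective R F

end Defs

end GorensteinPrecover

end

namespace GorensteinPrecover

section ProdModule

variable (R₁ : Type u) (R₂ : Type u) [Ring R₁] [Ring R₂]
variable (M₁ : Type v) (M₂ : Type v) [AddCommGroup M₁] [Module R₁ M₁]
  [AddCommGroup M₂] [Module R₂ M₂]

/-- The componentwise scalar action of a product ring `R₁ × R₂` on `M₁ × M₂`. -/
instance prodRingSMul : SMul (R₁ × R₂) (M₁ × M₂) :=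
  ⟨fun r m => (r.1 • m.1, r.2 • m.2)⟩

@[simp] lemma prodRing_smul_def (r : R₁ × R₂) (m : M₁ × M₂) :
    r • m = (r.1 • m.1, r.2 • m.2) := rfl

/-- The canonical left module structure of the product ring `R₁ × R₂` on `M₁ × M₂`,
for `M₁` a left `R₁`-module and `M₂` a left `R₂`-module. -/
instance prodRingModule : Module (R₁ × R₂) (M₁ × M₂) where
  one_smul m := by simp
  mul_smul r s m := by simp [mul_smul]
  smul_zero r := by simp
  smul_add r m m' := by simp [smul_add]
  add_smul r s m := by simp [add_smul]
  zero_smul m := by simp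

end ProdModule

section Helpers

section Corner

variable {R S : Type u} [Ring R] [Ring S] (φ : R →ₙ+* S)
variable (Q : Type v) [AddCommGroup Q] [Module S Q]

/-- The part of `Q` fixed by the idempotent `φ 1`. -/
def Corner : AddSubgroup Q where
  carrier := {x | φ 1 • x = x}
  zero_mem' := by simp
  add_mem' := by
    intro a b ha hb
    simp only [Set.mem_ofPred_eq] at *
    rw [smul_add, ha, hb]
  neg_mem' := by
    intro a ha
    simp only [Set.mem_ofPred_eq] at *
    rw [smul_neg, ha]

lemma mem_corner {x : Q} : x ∈ Corner φ Q ↔ φ 1 • x = x := Iff.rfl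

lemma smul_mem_corner (r : R) (x : Q) : φ r • x ∈ Corner φ Q := by
  rw [mem_corner, ← mul_smul, ← map_mul, one_mul]

instance cornerModule : Module R (Corner φ Q) where
  smul r x := ⟨φ r • (x : Q), smul_mem_corner φ Q r x⟩
  one_smul x := Subtype.ext x.2
  mul_smul r s x := Subtype.ext (by
    change φ (r * s) • (x : Q) = φ r • φ s • (x : Q)
    rw [map_mul, mul_smul])
  smul_zero r := Subtype.ext (smul_zero (φ r))
  smul_add r x y := Subtype.ext (smul_add (φ r) (x : Q) y)
  add_smul r s x := Subtype.ext (by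
    change φ (r + s) • (x : Q) = φ r • (x : Q) + φ s • (x : Q)
    rw [map_add, add_smul])
  zero_smul x := Subtype.ext (by
    change φ 0 • (x : Q) = 0
    rw [map_zero, zero_smul])

lemma corner_coe_smul (r : R) (x : Corner φ Q) : ((r • x : Corner φ Q) : Q) = φ r • (x : Q) := rfl

lemma corner_projective (ψ : S →+* R) (h1 : ∀ s, φ (ψ s) = φ 1 * s) (h2 : ∀ r, ψ (φ r) = r)
    (hQ : Module.Projective S Q) : Module.Projective R (Corner φ Q) := by
  obtain ⟨s, hs⟩ := hQ.out
  let i : Corner φ Q →ₗ[R] (Q →₀ R) :=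
    { toFun := fun x => (s x).mapRange ψ (map_zero ψ)
      map_add' := fun x y => by ext q; simp
      map_smul' := fun r x => by ext q; simp [corner_coe_smul, h2] }
  let t : Q → (R →ₗ[R] Corner φ Q) := fun q =>
    { toFun := fun r => ⟨φ r • q, smul_mem_corner φ Q r q⟩
      map_add' := fun a b => Subtype.ext (by simp [add_smul])
      map_smul' := fun a b => Subtype.ext (by simp [corner_coe_smul, mul_smul]) }
  let p : (Q →₀ R) →ₗ[R] Corner φ Q := Finsupp.lsum ℕ t
  refine Module.Projective.of_split i p ?_
  have key : ∀ z : Q →₀ S, ((p (z.mapRange ψ (map_zero ψ)) : Corner φ Q) : Q)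
      = φ 1 • Finsupp.linearCombination S id z := by
    intro z
    induction z using Finsupp.induction_linear with
    | zero => simp
    | add a b ha hb =>
      rw [Finsupp.mapRange_add (fun x y => map_add ψ x y), map_add, AddSubgroup.coe_add, ha, hb, map_add,
        smul_add]
    | single q c =>
      simp [p, t, h1, mul_smul]
  ext x
  have := key (s x)
  rw [hs] at this
  exact this.trans x.2

end Corner

variable {R₁ R₂ : Type u} [Ring R₁] [Ring R₂]

/-- First inclusion. -/
def phi₁ (R₁ R₂ : Type u) [Ring R₁] [Ring R₂] : R₁ →ₙ+* R₁ × R₂ where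
  toFun r := (r, 0)
  map_mul' := by simp
  map_zero' := rfl
  map_add' := by simp

/-- Second inclusion. -/
def phi₂ (R₁ R₂ : Type u) [Ring R₁] [Ring R₂] : R₂ →ₙ+* R₁ × R₂ where
  toFun r := (0, r)
  map_mul' := by simp
  map_zero' := rfl
  map_add' := by simp

lemma phi₁_apply (r : R₁) : phi₁ R₁ R₂ r = (r, 0) := rfl
lemma phi₂_apply (r : R₂) : phi₂ R₁ R₂ r = (0, r) := rfl

section PM
variable {A₁ B₁ C₁ A₂ B₂ C₂ : Type v} [AddCommGroup A₁] [Module R₁ A₁] [AddCommGroup B₁]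
  [Module R₁ B₁] [AddCommGroup C₁] [Module R₁ C₁] [AddCommGroup A₂] [Module R₂ A₂]
  [AddCommGroup B₂] [Module R₂ B₂] [AddCommGroup C₂] [Module R₂ C₂]

/-- The product of an `R₁`-linear and an `R₂`-linear map. -/
def pm (f : A₁ →ₗ[R₁] B₁) (g : A₂ →ₗ[R₂] B₂) : (A₁ × A₂) →ₗ[R₁ × R₂] (B₁ × B₂) where
  toFun x := (f x.1, g x.2)
  map_add' x y := by simp
  map_smul' r x := by simp

@[simp] lemma pm_apply (f : A₁ →ₗ[R₁] B₁) (g : A₂ →ₗ[R₂] B₂) (x : A₁ × A₂) :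
    pm f g x = (f x.1, g x.2) := rfl

lemma pm_exact {f : A₁ →ₗ[R₁] B₁} {f' : B₁ →ₗ[R₁] C₁} {g : A₂ →ₗ[R₂] B₂} {g' : B₂ →ₗ[R₂] C₂}
    (hf : Function.Exact f f') (hg : Function.Exact g g') :
    Function.Exact (pm f g) (pm f' g') := by
  rintro ⟨x, y⟩
  have h1 := hf x
  have h2 := hg y
  simp only [pm_apply, Prod.mk_eq_zero, h1, h2, Set.mem_range, Prod.exists, Prod.mk.injEq]
  constructor
  · rintro ⟨⟨a, ha⟩, ⟨b, hb⟩⟩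
    exact ⟨a, b, ha, hb⟩
  · rintro ⟨a, b, ha, hb⟩
    exact ⟨⟨a, ha⟩, ⟨b, hb⟩⟩

lemma prod_projective (h₁ : Module.Projective R₁ A₁) (h₂ : Module.Projective R₂ A₂) :
    Module.Projective (R₁ × R₂) (A₁ × A₂) := by
  obtain ⟨s₁, hs₁⟩ := h₁.out
  obtain ⟨s₂, hs₂⟩ := h₂.out
  let i : (A₁ × A₂) →ₗ[R₁ × R₂] (A₁ ⊕ A₂ →₀ R₁ × R₂) :=
    { toFun := fun x =>
        ((s₁ x.1).mapRange (phi₁ R₁ R₂) (map_zero _)).mapDomain Sum.inl +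
        ((s₂ x.2).mapRange (phi₂ R₁ R₂) (map_zero _)).mapDomain Sum.inr
      map_add' := fun x y => by
        simp only [Prod.fst_add, Prod.snd_add, map_add,
          Finsupp.mapRange_add (fun x y => map_add (phi₁ R₁ R₂) x y),
          Finsupp.mapRange_add (fun x y => map_add (phi₂ R₁ R₂) x y), Finsupp.mapDomain_add]
        abel
      map_smul' := fun r x => by
        have e1 : (r.1 • s₁ x.1).mapRange (phi₁ R₁ R₂) (map_zero _)
            = r • (s₁ x.1).mapRange (phi₁ R₁ R₂) (map_zero _) := by
          ext q <;> simp [phi₁_apply]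
        have e2 : (r.2 • s₂ x.2).mapRange (phi₂ R₁ R₂) (map_zero _)
            = r • (s₂ x.2).mapRange (phi₂ R₁ R₂) (map_zero _) := by
          ext q <;> simp [phi₂_apply]
        simp only [prodRing_smul_def R₁ R₂ A₁ A₂, map_smul, e1, e2, Finsupp.mapDomain_smul, smul_add,
          RingHom.id_apply] }
  let p : (A₁ ⊕ A₂ →₀ R₁ × R₂) →ₗ[R₁ × R₂] (A₁ × A₂) :=
    Finsupp.linearCombination (R₁ × R₂) (Sum.elim (fun a => (a, 0)) (fun b => (0, b)))
  have k1 : ∀ z : A₁ →₀ R₁, p ((z.mapRange (phi₁ R₁ R₂) (map_zero _)).mapDomain Sum.inl)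
      = (Finsupp.linearCombination R₁ id z, 0) := by
    intro z
    induction z using Finsupp.induction_linear with
    | zero => simp [Prod.zero_eq_mk]
    | add a b ha hb =>
      rw [Finsupp.mapRange_add (fun x y => map_add (phi₁ R₁ R₂) x y), Finsupp.mapDomain_add, map_add,
        ha, hb, map_add]
      simp
    | single q c => simp [p, phi₁_apply, Finsupp.mapDomain_single]
  have k2 : ∀ z : A₂ →₀ R₂, p ((z.mapRange (phi₂ R₁ R₂) (map_zero _)).mapDomain Sum.inr)
      = (0, Finsupp.linearCombination R₂ id z) := by
    intro z
    induction z using Finsupp.induction_linear with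
    | zero => simp [Prod.zero_eq_mk]
    | add a b ha hb =>
      rw [Finsupp.mapRange_add (fun x y => map_add (phi₂ R₁ R₂) x y), Finsupp.mapDomain_add, map_add,
        ha, hb, map_add]
      simp
    | single q c => simp [p, phi₂_apply, Finsupp.mapDomain_single]
  refine Module.Projective.of_split i p ?_
  refine LinearMap.ext fun x => ?_
  change p (_ + _) = x
  rw [map_add, k1, k2, hs₁, hs₂]
  simp

/-- The first component of a map out of a product. -/
def comp₁ {Q : Type v} [AddCommGroup Q] [Module (R₁ × R₂) Q] (f : (A₁ × A₂) →ₗ[R₁ × R₂] Q) :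
    A₁ →ₗ[R₁] Corner (phi₁ R₁ R₂) Q where
  toFun a := ⟨f (a, 0), by rw [mem_corner, ← map_smul]; simp [phi₁_apply]⟩
  map_add' a b := Subtype.ext (by
    change f (a + b, 0) = f (a, 0) + f (b, 0)
    rw [← map_add]; simp)
  map_smul' r a := Subtype.ext (by
    change f (r • a, 0) = phi₁ R₁ R₂ r • f (a, 0)
    rw [← map_smul]; simp [phi₁_apply])

/-- The second component of a map out of a product. -/
def comp₂ {Q : Type v} [AddCommGroup Q] [Module (R₁ × R₂) Q] (f : (A₁ × A₂) →ₗ[R₁ × R₂] Q) :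
    A₂ →ₗ[R₂] Corner (phi₂ R₁ R₂) Q where
  toFun a := ⟨f (0, a), by rw [mem_corner, ← map_smul]; simp [phi₂_apply]⟩
  map_add' a b := Subtype.ext (by
    change f (0, a + b) = f (0, a) + f (0, b)
    rw [← map_add]; simp)
  map_smul' r a := Subtype.ext (by
    change f (0, r • a) = phi₂ R₁ R₂ r • f (0, a)
    rw [← map_smul]; simp [phi₂_apply])

/-- Glue a pair of maps into the corners. -/
def glue {Q : Type v} [AddCommGroup Q] [Module (R₁ × R₂) Q]
    (f : A₁ →ₗ[R₁] Corner (phi₁ R₁ R₂) Q) (g : A₂ →ₗ[R₂] Corner (phi₂ R₁ R₂) Q) :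
    (A₁ × A₂) →ₗ[R₁ × R₂] Q where
  toFun x := f x.1 + g x.2
  map_add' x y := by
    simp only [Prod.fst_add, Prod.snd_add, map_add, AddSubgroup.coe_add]
    abel
  map_smul' r x := by
    have e1 : r • ((f x.1 : Corner (phi₁ R₁ R₂) Q) : Q) = phi₁ R₁ R₂ r.1 • (f x.1 : Q) := by
      conv_lhs => rw [← (mem_corner _ _).1 (f x.1).2]
      rw [← mul_smul]; simp [phi₁_apply, Prod.mul_def]
    have e2 : r • ((g x.2 : Corner (phi₂ R₁ R₂) Q) : Q) = phi₂ R₁ R₂ r.2 • (g x.2 : Q) := by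
      conv_lhs => rw [← (mem_corner _ _).1 (g x.2).2]
      rw [← mul_smul]; simp [phi₂_apply, Prod.mul_def]
    simp only [prodRing_smul_def R₁ R₂ A₁ A₂, map_smul, corner_coe_smul, RingHom.id_apply, smul_add, e1, e2]

lemma hom_exact {Q : Type v} [AddCommGroup Q] [Module (R₁ × R₂) Q]
    {f : A₁ →ₗ[R₁] B₁} {f' : B₁ →ₗ[R₁] C₁} {g : A₂ →ₗ[R₂] B₂} {g' : B₂ →ₗ[R₂] C₂}
    (hf : Function.Exact (fun h : C₁ →ₗ[R₁] Corner (phi₁ R₁ R₂) Q => h.comp f')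
      (fun h : B₁ →ₗ[R₁] Corner (phi₁ R₁ R₂) Q => h.comp f))
    (hg : Function.Exact (fun h : C₂ →ₗ[R₂] Corner (phi₂ R₁ R₂) Q => h.comp g')
      (fun h : B₂ →ₗ[R₂] Corner (phi₂ R₁ R₂) Q => h.comp g))
    (hf0 : Function.Exact f f') (hg0 : Function.Exact g g') :
    Function.Exact (fun h : (C₁ × C₂) →ₗ[R₁ × R₂] Q => h.comp (pm f' g'))
      (fun h : (B₁ × B₂) →ₗ[R₁ × R₂] Q => h.comp (pm f g)) := by
  intro h
  constructor
  · intro hh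
    have hh' : ∀ a b, h (f a, g b) = 0 := fun a b => LinearMap.congr_fun hh (a, b)
    obtain ⟨k₁, hk₁⟩ := (hf (comp₁ h)).1 (LinearMap.ext fun a => Subtype.ext (by
      have := hh' a 0
      rw [map_zero] at this
      exact this))
    obtain ⟨k₂, hk₂⟩ := (hg (comp₂ h)).1 (LinearMap.ext fun a => Subtype.ext (by
      have := hh' 0 a
      rw [map_zero] at this
      exact this))
    refine ⟨glue k₁ k₂, LinearMap.ext fun x => ?_⟩
    have e1 : (k₁ (f' x.1) : Q) = h (x.1, 0) := congrArg Subtype.val (LinearMap.congr_fun hk₁ x.1)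
    have e2 : (k₂ (g' x.2) : Q) = h (0, x.2) := congrArg Subtype.val (LinearMap.congr_fun hk₂ x.2)
    change (k₁ (f' x.1) : Q) + (k₂ (g' x.2) : Q) = h x
    rw [e1, e2, ← map_add]
    simp
  · rintro ⟨k, rfl⟩
    refine LinearMap.ext fun x => ?_
    change k (pm f' g' (pm f g x)) = 0
    rw [(pm_exact hf0 hg0).apply_apply_eq_zero, map_zero]

/-- Kernel of a product map. -/
def kerEquiv {M₁ M₂ : Type v} [AddCommGroup M₁] [Module R₁ M₁] [AddCommGroup M₂] [Module R₂ M₂]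
    (f : A₁ →ₗ[R₁] B₁) (g : A₂ →ₗ[R₂] B₂) (e₁ : M₁ ≃ₗ[R₁] LinearMap.ker f)
    (e₂ : M₂ ≃ₗ[R₂] LinearMap.ker g) : (M₁ × M₂) ≃ₗ[R₁ × R₂] LinearMap.ker (pm f g) where
  toFun x := ⟨((e₁ x.1 : A₁), (e₂ x.2 : A₂)), by
    rw [LinearMap.mem_ker, pm_apply, (e₁ x.1).2, (e₂ x.2).2]; rfl⟩
  map_add' x y := Subtype.ext (by simp)
  map_smul' r x := Subtype.ext (by simp)
  invFun y := (e₁.symm ⟨y.1.1, congrArg Prod.fst y.2⟩, e₂.symm ⟨y.1.2, congrArg Prod.snd y.2⟩)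
  left_inv x := Prod.ext (e₁.symm_apply_apply x.1) (e₂.symm_apply_apply x.2)
  right_inv y := by simp

end PM

lemma isGorensteinProjective_prod {M₁ : ModuleCat.{v} R₁} {M₂ : ModuleCat.{v} R₂}
    (h₁ : IsGorensteinProjective R₁ M₁) (h₂ : IsGorensteinProjective R₂ M₂) :
    IsGorensteinProjective (R₁ × R₂)
      (ModuleCat.of (R₁ × R₂) (Prod (M₁ : Type v) (M₂ : Type v))) := by
  obtain ⟨P, d, hP, hd, hH, ⟨e⟩⟩ := h₁
  obtain ⟨P', d', hP', hd', hH', ⟨e'⟩⟩ := h₂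
  refine ⟨fun i => ModuleCat.of (R₁ × R₂) (Prod (P i : Type v) (P' i : Type v)),
    fun i => pm (d i) (d' i), fun i => prod_projective (hP i) (hP' i),
    fun i => pm_exact (hd i) (hd' i), fun Q hQ i => ?_, ⟨kerEquiv _ _ e e'⟩⟩
  have q1 : Module.Projective R₁ (Corner (phi₁ R₁ R₂) Q) :=
    corner_projective _ _ (RingHom.fst R₁ R₂) (by simp [phi₁_apply, Prod.mul_def])
      (by simp [phi₁_apply]) hQ
  have q2 : Module.Projective R₂ (Corner (phi₂ R₁ R₂) Q) :=
    corner_projective _ _ (RingHom.snd R₁ R₂) (by simp [phi₂_apply, Prod.mul_def])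
      (by simp [phi₂_apply]) hQ
  exact hom_exact (hH (ModuleCat.of R₁ (Corner (phi₁ R₁ R₂) Q)) q1 i)
    (hH' (ModuleCat.of R₂ (Corner (phi₂ R₁ R₂) Q)) q2 i) (hd i) (hd' i)

end Helpers

/-- For rings `R₁`, `R₂` and `Γ = R₁ × R₂`, the Gorenstein
projective dimension of a left `Γ`-module `N = N₁ ⊕ N₂` satisfies
`Gpd_Γ(N) ≤ max {Gpd_{R₁}(N₁), Gpd_{R₂}(N₂)}`; in particular it is finite whenever
both `Gpd_{R₁}(N₁)` and `Gpd_{R₂}(N₂)` are. -/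
theorem gorProjDim_prod_le_max
    (R₁ R₂ : Type u) [Ring R₁] [Ring R₂]
    (N₁ : ModuleCat.{v} R₁) (N₂ : ModuleCat.{v} R₂) (d₁ d₂ : ℕ)
    (h₁ : GorProjDimLE R₁ N₁ d₁) (h₂ : GorProjDimLE R₂ N₂ d₂) :
    GorProjDimLE (R₁ × R₂)
      (ModuleCat.of (R₁ × R₂) (Prod (N₁ : Type v) (N₂ : Type v))) (max d₁ d₂) := by
  obtain ⟨G, d, p, hG, hp, h0, hd, hs⟩ := h₁
  obtain ⟨G', d', p', hG', hp', h0', hd', hs'⟩ := h₂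
  refine ⟨fun i => ModuleCat.of (R₁ × R₂) (Prod (G i : Type v) (G' i : Type v)),
    fun i => pm (d i) (d' i), pm p p', fun i => isGorensteinProjective_prod (hG i) (hG' i),
    ?_, pm_exact h0 h0', fun i => pm_exact (hd i) (hd' i), fun i hi => ?_⟩
  · rintro ⟨x, y⟩
    obtain ⟨a, rfl⟩ := hp x
    obtain ⟨b, rfl⟩ := hp' y
    exact ⟨(a, b), rfl⟩
  · have := hs i (lt_of_le_of_lt (le_max_left _ _) hi)
    have := hs' i (lt_of_le_of_lt (le_max_right _ _) hi)
    exact inferInstanceAs (Subsingleton (Prod (G i : Type v) (G' i : Type v)))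

end GorensteinPrecover
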